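/- Let R be an associative ring with identity, let (A,B) be a hereditary cotorsion pair in Mod R, and let Y be a CE B complex. Then for every module A ∈ A and every s ∈ ℤ the canonical map δ_s : Hom_{D(R)}(S(A), Y⟦s⟧) → Hom_R(A, H^s(Y)) is bijective. (The inclusion CE-B ⊆ B_I of Lemma 2.4.) -/

import Mathlib

open CategoryTheory Limits DerivedCategory Pretriangulated

noncomputable section

universe w u

variable {R : Type u} [Ring R]

def Ext1Zero [HasExt.{w} (ModuleCat.{u} R)] (A B : ModuleCat.{u} R) : Prop :=
  Subsingleton (Abelian.Ext A B 1)

def IsSES {K M N : ModuleCat.{u} R} (i : K ⟶ M) (p : M ⟶ N) : Prop :=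
  Function.Injective i ∧ Function.Surjective p ∧ Function.Exact i p

def IsCotorsionPair [HasExt.{w} (ModuleCat.{u} R)] (A B : Set (ModuleCat.{u} R)) : Prop :=
  (∀ M : ModuleCat.{u} R, M ∈ A ↔ ∀ N ∈ B, Ext1Zero M N) ∧
  (∀ N : ModuleCat.{u} R, N ∈ B ↔ ∀ M ∈ A, Ext1Zero M N)

def IsCompleteCP (A B : Set (ModuleCat.{u} R)) : Prop :=
  ∀ M : ModuleCat.{u} R,
    (∃ (B' A' : ModuleCat.{u} R) (i : B' ⟶ A') (p : A' ⟶ M),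
      B' ∈ B ∧ A' ∈ A ∧ IsSES i p) ∧
    (∃ (B' A' : ModuleCat.{u} R) (i : M ⟶ B') (p : B' ⟶ A'),
      B' ∈ B ∧ A' ∈ A ∧ IsSES i p)

def IsHereditaryCP (A B : Set (ModuleCat.{u} R)) : Prop :=
  (∀ (K A₁ A₂ : ModuleCat.{u} R) (i : K ⟶ A₁) (p : A₁ ⟶ A₂),
    A₁ ∈ A → A₂ ∈ A → IsSES i p → K ∈ A) ∧
  (∀ (B₁ B₂ K : ModuleCat.{u} R) (i : B₁ ⟶ B₂) (p : B₂ ⟶ K),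
    B₁ ∈ B → B₂ ∈ B → IsSES i p → K ∈ B)

def IsCE (S : Set (ModuleCat.{u} R)) (W : CochainComplex (ModuleCat.{u} R) ℤ) : Prop :=
  ∀ s : ℤ, W.X s ∈ S ∧ W.cycles s ∈ S ∧ image (W.d (s-1) s) ∈ S ∧ W.homology s ∈ S

variable [HasDerivedCategory.{w} (ModuleCat.{u} R)]

def stalk (M : ModuleCat.{u} R) : DerivedCategory (ModuleCat.{u} R) :=
  DerivedCategory.Q.obj
    ((HomologicalComplex.single (ModuleCat.{u} R) (ComplexShape.up ℤ) 0).obj M)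

def stalkHomologyIso (M : ModuleCat.{u} R) :
    (homologyFunctor (ModuleCat.{u} R) 0).obj (stalk M) ≅ M :=
  (homologyFunctorFactors (ModuleCat.{u} R) 0).app _ ≪≫
    (HomologicalComplex.homologyFunctorSingleIso (ModuleCat.{u} R) (ComplexShape.up ℤ) 0).app M

def shiftHomologyIso (X : DerivedCategory (ModuleCat.{u} R)) (s a a' : ℤ) (h : s + a = a') :
    (homologyFunctor (ModuleCat.{u} R) a).obj (X⟦s⟧) ≅
      (homologyFunctor (ModuleCat.{u} R) a').obj X :=
  ((homologyFunctor (ModuleCat.{u} R) 0).shiftIso s a a' h).app X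

def deltaMap (M : ModuleCat.{u} R) (X : DerivedCategory (ModuleCat.{u} R)) (s : ℤ)
    (f : stalk M ⟶ X⟦s⟧) : M ⟶ (homologyFunctor (ModuleCat.{u} R) s).obj X :=
  (stalkHomologyIso M).inv ≫ (homologyFunctor (ModuleCat.{u} R) 0).map f ≫
    (shiftHomologyIso X s 0 s (add_zero s)).hom

section ExtVanishing

open Abelian

variable {R : Type u} [Ring R]

lemma IsSES.shortExact (S : ShortComplex (ModuleCat.{u} R)) (hS : S.ShortExact) :
    IsSES S.f S.g :=
  ⟨(ModuleCat.mono_iff_injective _).1 hS.mono_f, (ModuleCat.epi_iff_surjective _).1 hS.epi_g,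
    (ShortComplex.ShortExact.moduleCat_exact_iff_function_exact S).1 hS.exact⟩

/-- For a hereditary cotorsion pair, all positive `Ext` groups vanish. -/
lemma subsingleton_ext_of_hereditary [HasExt.{w} (ModuleCat.{u} R)]
    {A B : Set (ModuleCat.{u} R)} (hcp : IsCotorsionPair A B) (hhered : IsHereditaryCP A B)
    {N : ModuleCat.{u} R} (hN : N ∈ B) (n : ℕ) :
    ∀ M ∈ A, Subsingleton (Ext.{w} M N (n + 1)) := by
  induction n with
  | zero => exact fun M hM ↦ (hcp.1 M).1 hM N hN
  | succ n ih =>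
    intro M hM
    have hS := M.shortExact_projectiveShortComplex
    have : Projective M.projectiveShortComplex.X₂ :=
      ModuleCat.projective_of_free (Module.Free.chooseBasis R M.projectiveShortComplex.X₂)
    have hP : M.projectiveShortComplex.X₂ ∈ A :=
      (hcp.1 _).2 fun N' _ ↦ Ext.subsingleton_of_projective _ _ _
    have : Subsingleton (Ext.{w} M.projectiveShortComplex.X₁ N (n + 1)) :=
      ih _ (hhered.1 _ _ _ _ _ hP hM (IsSES.shortExact _ hS))
    refine subsingleton_of_forall_eq 0 fun x ↦ ?_
    obtain ⟨y, rfl⟩ := Ext.contravariant_sequence_exact₃ hS N x (Ext.eq_zero_of_projective _)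
      (add_comm 1 (n + 1))
    rw [Subsingleton.elim y 0, Ext.comp_zero]

end ExtVanishing

section Complexes

variable {C : Type*} [Category* C] [Abelian C]

/-- A cocycle on a projective resolution of `M` with values in `N`, in a negative degree in which
`Ext M N` vanishes, is a coboundary. -/
lemma CategoryTheory.ProjectiveResolution.exists_d_comp_eq [HasExt.{w} C] {M N : C}
    (P : ProjectiveResolution M) (h : ∀ n : ℕ, Subsingleton (Abelian.Ext.{w} M N (n + 1)))
    {i j : ℤ} (hij : i + 1 = j) (hi : i < 0) (f : P.cochainComplex.X i ⟶ N)
    (hf : P.cochainComplex.d (i - 1) i ≫ f = 0) :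
    ∃ g : P.cochainComplex.X j ⟶ N, P.cochainComplex.d i j ≫ g = f := by
  obtain ⟨n, hn⟩ : ∃ n : ℕ, j = -n := ⟨(-j).toNat, by lia⟩
  have e₁ := P.cochainComplex_d i j (n + 1) n
  have e₂ := P.cochainComplex_d (i - 1) i (n + 2) (n + 1)
  rw [e₂] at hf
  have hf' : P.complex.d (n + 2) (n + 1) ≫
      (P.cochainComplexXIso i (n + 1)).inv ≫ f = 0 := by
    rw [← cancel_epi (P.cochainComplexXIso (i - 1) (n + 2)).hom]
    simpa using hf
  obtain ⟨g, hg⟩ := (P.extMk_eq_zero_iff _ (n + 2) rfl hf' n rfl).1 (Subsingleton.elim _ _)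
  exact ⟨(P.cochainComplexXIso j n).hom ≫ g, by simp [e₁, hg]⟩

namespace CochainComplex

open HomologicalComplex

variable (K W : CochainComplex C ℤ)

/-- Negative degree cocycles of `K` with values in the cocycles of `W` are coboundaries. -/
def CocyclesExtend : Prop :=
  ∀ ⦃i j : ℤ⦄, i + 1 = j → i < 0 → ∀ ⦃k l : ℤ⦄, k + 1 = l → ∀ b : K.X i ⟶ W.X k,
    b ≫ W.d k l = 0 → K.d (i - 1) i ≫ b = 0 →
      ∃ g : K.X j ⟶ W.X k, K.d i j ≫ g = b ∧ g ≫ W.d k l = 0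

/-- Negative degree cocycles of `K` with values in the coboundaries of `W` are coboundaries. -/
def CoboundariesExtend : Prop :=
  ∀ ⦃i j : ℤ⦄, i + 1 = j → i < 0 → ∀ ⦃k l : ℤ⦄, k + 1 = l → ∀ a : K.X i ⟶ W.X k,
    K.d (i - 1) i ≫ a ≫ W.d k l = 0 →
      ∃ g : K.X j ⟶ W.X k, K.d i j ≫ g ≫ W.d k l = a ≫ W.d k l

variable {K W}

lemma comp_shiftFunctor_obj_d {X : C} (s k l : ℤ) (b : X ⟶ W.X (k + s)) :
    b ≫ (W⟦s⟧).d k l = (s.negOnePow • (b ≫ W.d (k + s) (l + s)) : X ⟶ W.X (l + s)) :=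
  Linear.comp_units_smul _ _ _

lemma CocyclesExtend.shift (h : K.CocyclesExtend W) (s : ℤ) : K.CocyclesExtend (W⟦s⟧) := by
  intro i j hij hi k l hkl b hb hb'
  obtain ⟨g, hg, hg'⟩ := h hij hi (k := k + s) (l := l + s) (by lia) b
    ((smul_eq_zero_iff_eq s.negOnePow).1 ((comp_shiftFunctor_obj_d s k l b).symm.trans hb)) hb'
  exact ⟨g, hg, (comp_shiftFunctor_obj_d s k l g).trans (by rw [hg', smul_zero]; rfl)⟩

lemma CoboundariesExtend.shift (h : K.CoboundariesExtend W) (s : ℤ) :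
    K.CoboundariesExtend (W⟦s⟧) := by
  intro i j hij hi k l hkl a ha
  obtain ⟨g, hg⟩ := h hij hi (k := k + s) (l := l + s) (by lia) a
    ((Category.assoc _ _ _).symm.trans ((smul_eq_zero_iff_eq s.negOnePow).1
      ((comp_shiftFunctor_obj_d s k l _).symm.trans ((Category.assoc _ _ _).trans ha))))
  refine ⟨g, (Category.assoc _ _ _).symm.trans ((comp_shiftFunctor_obj_d s k l _).trans ?_)⟩
  refine Eq.trans (congrArg (s.negOnePow • ·) ((Category.assoc _ _ _).trans hg)) ?_
  exact (comp_shiftFunctor_obj_d s k l a).symm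

lemma isIso_iCycles_zero [K.IsStrictlyLE 0] : IsIso (K.iCycles 0) :=
  K.isIso_iCycles 0 1 (by simp)
    ((K.isZero_of_isStrictlyLE 0 1).eq_of_tgt _ _)

/-- A morphism to the cycles of `W` which vanishes in homology lifts. -/
lemma exists_lift_toCycles (k l : ℤ) (hkl : k + 1 = l) {P : C} [Projective P]
    (c : P ⟶ W.cycles l) (hc : c ≫ W.homologyπ l = 0) :
    ∃ a : P ⟶ W.X k, a ≫ W.toCycles k l = c := by
  have hS : (ShortComplex.mk _ _ (W.toCycles_comp_homologyπ k l)).Exact :=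
    ShortComplex.exact_of_g_is_cokernel _ (W.homologyIsCokernel k l (by simp; lia))
  exact ⟨hS.liftFromProjective c hc, hS.liftFromProjective_comp c hc⟩

variable [K.IsStrictlyLE 0] [∀ n, Projective (K.X n)]

/-- A morphism whose degree zero homology vanishes is homotopic to zero. -/
lemma nonempty_homotopy_zero (hZ : K.CocyclesExtend W) (hB : K.CoboundariesExtend W)
    (f : K ⟶ W) (hf : homologyMap f 0 = 0) : Nonempty (Homotopy f 0) := by
  have h₁ : ∀ i j : ℤ, (ComplexShape.up ℤ).Rel j i → ∃ a : K.X i ⟶ W.X j,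
      K.d j i ≫ a ≫ W.d j i = f.f j ≫ W.d j i := by
    intro i j (hij : j + 1 = i)
    by_cases hj : j < 0
    · exact hB hij hj hij (f.f j) (by simp)
    · exact ⟨0, by rw [f.comm, (K.isZero_of_isStrictlyLE 0 i).eq_of_tgt (K.d j i) 0]; simp⟩
  choose a ha using h₁
  obtain ⟨f', hf', ⟨H⟩⟩ : ∃ f' : K ⟶ W, (∀ i j : ℤ, i + 1 = j → f'.f i ≫ W.d i j = 0) ∧
      Nonempty (Homotopy f f') := by
    refine ⟨f - Homotopy.nullHomotopicMap' a, fun i j hij ↦ ?_, ⟨?_⟩⟩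
    · rw [sub_f_apply, Homotopy.nullHomotopicMap'_f (k₂ := i - 1) (k₀ := j) (by simp) hij]
      simp [Preadditive.sub_comp, Preadditive.add_comp]
      rw [sub_eq_zero, ← f.comm]
      exact (ha _ _ hij).symm
    · exact (Homotopy.equivSubZero).symm
        ((Homotopy.ofEq (by simp)).trans (Homotopy.nullHomotopy' a))
  have hH : homologyMap f' 0 = 0 := by rw [← H.homologyMap_eq, hf]
  have := isIso_iCycles_zero (K := K)
  obtain ⟨e, he, he'⟩ : ∃ e : K.X 0 ⟶ W.X (-1), e ≫ W.d (-1) 0 = f'.f 0 ∧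
      K.d (-1) 0 ≫ e = 0 := by
    let c : K.X 0 ⟶ W.cycles 0 := W.liftCycles (f'.f 0) 1 (by simp) (hf' _ _ (by simp))
    have hc : c ≫ W.homologyπ 0 = 0 := by
      have : K.iCycles 0 ≫ c = cyclesMap f' 0 := by
        simp [c, ← cancel_mono (W.iCycles 0)]
      rw [← cancel_epi (K.iCycles 0), ← Category.assoc, this,
        ← homologyπ_naturality, hH, comp_zero, comp_zero]
    obtain ⟨g, hg⟩ := exists_lift_toCycles (-1) 0 (by simp) c hc
    have hg' : g ≫ W.d (-1) 0 = f'.f 0 := by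
      rw [← W.toCycles_i, ← Category.assoc, hg]
      simp [c]
    obtain ⟨z, hz, hz'⟩ := hZ (i := -1) (j := 0) (by simp) (by simp) (k := -1) (l := 0) (by simp)
      (K.d (-1) 0 ≫ g) (by simp [hg', ← f'.comm, hf' (-1) 0]) (by simp)
    exact ⟨g - z, by simp [Preadditive.sub_comp, hg', hz'], by simp [Preadditive.comp_sub, hz]⟩
  have h₂ : ∀ i j : ℤ, (ComplexShape.up ℤ).Rel j i → ∃ b : K.X i ⟶ W.X j,
      (j < 0 → K.d j i ≫ b = f'.f j) ∧ (i < 0 → b ≫ W.d j i = 0) ∧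
      (i = 0 → b ≫ W.d j i = f'.f i) := by
    intro i j (hij : j + 1 = i)
    by_cases hj : j < 0
    · obtain ⟨g, hg, hg'⟩ := hZ hij hj hij (f'.f j) (hf' _ _ hij)
        (by rw [← f'.comm, hf' _ _ (by simp)])
      by_cases hi : i = 0
      · obtain rfl : j = -1 := by lia
        subst hi
        exact ⟨g + e, by simp [Preadditive.comp_add, hg, he'], by simp,
          by simp [Preadditive.add_comp, hg', he]⟩
      · exact ⟨g, fun _ ↦ hg, fun _ ↦ hg', fun h ↦ (hi h).elim⟩
    · exact ⟨0, fun h ↦ (hj h).elim, fun h ↦ by lia, fun h ↦ by lia⟩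
  choose b hb₁ hb₂ hb₃ using h₂
  have hf'b : f' = Homotopy.nullHomotopicMap' b := by
    ext i
    rw [Homotopy.nullHomotopicMap'_f (k₂ := i - 1) (k₀ := i + 1) (by simp) (by simp)]
    obtain hi | rfl | hi := lt_trichotomy i 0
    · rw [hb₁ _ _ _ hi, hb₂ _ _ _ hi, add_zero]
    · rw [hb₃ _ _ _ rfl, (K.isZero_of_isStrictlyLE 0 (0 + 1)).eq_of_tgt (K.d 0 (0 + 1)) 0,
        zero_comp, zero_add]
    · exact (K.isZero_of_isStrictlyLE 0 i).eq_of_src _ _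
  exact ⟨H.trans ((Homotopy.ofEq hf'b).trans (Homotopy.nullHomotopy' b))⟩

/-- Any morphism on degree zero homology is induced by a morphism of complexes. -/
lemma exists_homologyMap_eq (hB : K.CoboundariesExtend W) (β : K.homology 0 ⟶ W.homology 0) :
    ∃ f : K ⟶ W, homologyMap f 0 = β := by
  have := isIso_iCycles_zero (K := K)
  let c := Projective.factorThru (inv (K.iCycles 0) ≫ K.homologyπ 0 ≫ β) (W.homologyπ 0)
  have hc : c ≫ W.homologyπ 0 = inv (K.iCycles 0) ≫ K.homologyπ 0 ≫ β :=
    Projective.factorThru_comp _ _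
  have hd : K.d (-1) 0 ≫ inv (K.iCycles 0) = K.toCycles (-1) 0 := by simp
  obtain ⟨a, ha⟩ := exists_lift_toCycles (-1) 0 (by simp) (K.d (-1) 0 ≫ c)
    (by rw [Category.assoc, hc, reassoc_of% hd]; simp)
  have ha' : a ≫ W.d (-1) 0 = K.d (-1) 0 ≫ c ≫ W.iCycles 0 := by
    rw [← W.toCycles_i, reassoc_of% ha]
  obtain ⟨g, hg⟩ := hB (i := -1) (j := 0) (by simp) (by simp) (k := -1) (l := 0) (by simp) a
    (by simp [ha'])
  let z : K.X 0 ⟶ W.cycles 0 := c - g ≫ W.toCycles (-1) 0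
  have hz : K.d (-1) 0 ≫ z = 0 := by
    rw [← cancel_mono (W.iCycles 0)]
    simp [z, Preadditive.comp_sub, Preadditive.sub_comp, hg, ha']
  let f : K ⟶ W :=
    mkHomToSingle (j := 0) z (by
      rintro i (hi : i + 1 = 0)
      obtain rfl : i = -1 := by lia
      exact hz) ≫
      mkHomFromSingle (W.iCycles 0) (by simp)
  have hf : cyclesMap f 0 = K.iCycles 0 ≫ z := by
    simp [← cancel_mono (W.iCycles 0), f]
  refine ⟨f, ?_⟩
  rw [← cancel_epi (K.homologyπ 0), homologyπ_naturality, hf]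
  simp [z, Preadditive.sub_comp, hc]

end CochainComplex

end Complexes

namespace IsCE

variable {R : Type u} [Ring R] [HasExt.{w} (ModuleCat.{u} R)] {A B : Set (ModuleCat.{u} R)}
  {Y : CochainComplex (ModuleCat.{u} R) ℤ} {M : ModuleCat.{u} R}

lemma cocyclesExtend (hcp : IsCotorsionPair A B) (hhered : IsHereditaryCP A B) (hY : IsCE B Y)
    (hM : M ∈ A) (P : ProjectiveResolution M) : P.cochainComplex.CocyclesExtend Y := by
  intro i j hij hi k l hkl b hb hb'
  obtain ⟨g, hg⟩ := P.exists_d_comp_eq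
    (fun n ↦ subsingleton_ext_of_hereditary hcp hhered (hY k).2.1 n M hM) hij hi
    (Y.liftCycles b l (by simp; lia) hb) (by simp [← cancel_mono (Y.iCycles k), hb'])
  exact ⟨g ≫ Y.iCycles k, by simp [reassoc_of% hg], by simp⟩

lemma coboundariesExtend (hcp : IsCotorsionPair A B) (hhered : IsHereditaryCP A B)
    (hY : IsCE B Y) (hM : M ∈ A) (P : ProjectiveResolution M) :
    P.cochainComplex.CoboundariesExtend Y := by
  intro i j hij hi k l hkl a ha
  obtain rfl : k = l - 1 := by lia
  obtain ⟨g, hg⟩ := P.exists_d_comp_eq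
    (fun n ↦ subsingleton_ext_of_hereditary hcp hhered (hY l).2.2.1 n M hM) hij hi
    (a ≫ factorThruImage (Y.d (l - 1) l)) (by
      rw [← cancel_mono (image.ι (Y.d (l - 1) l))]
      simpa using ha)
  refine ⟨Projective.factorThru g (factorThruImage (Y.d (l - 1) l)), ?_⟩
  have : Projective.factorThru g (factorThruImage (Y.d (l - 1) l)) ≫ Y.d (l - 1) l =
      g ≫ image.ι (Y.d (l - 1) l) := by
    rw [← Projective.factorThru_comp_assoc g (factorThruImage _), image.fac]
  rw [this, reassoc_of% hg, image.fac]

end IsCE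

lemma bijective_stalk_of_extend {M : ModuleCat.{u} R} (P : ProjectiveResolution M)
    {W : CochainComplex (ModuleCat.{u} R) ℤ} (hZ : P.cochainComplex.CocyclesExtend W)
    (hB : P.cochainComplex.CoboundariesExtend W) :
    Function.Bijective fun φ : stalk M ⟶ DerivedCategory.Q.obj W ↦
      (stalkHomologyIso M).inv ≫ (homologyFunctor (ModuleCat.{u} R) 0).map φ := by
  let H := homologyFunctor (ModuleCat.{u} R) 0
  let p : Q.obj P.cochainComplex ⟶ stalk M := Q.map P.π'
  have : IsIso p := inferInstanceAs (IsIso (Q.map P.π'))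
  have : P.cochainComplex.IsKProjective := CochainComplex.isKProjective_of_projective _ 0
  obtain ⟨e, he⟩ : ∃ e : ∀ K : CochainComplex (ModuleCat.{u} R) ℤ, H.obj (Q.obj K) ≅ K.homology 0,
      ∀ {K L : CochainComplex (ModuleCat.{u} R) ℤ} (f : K ⟶ L),
        H.map (Q.map f) ≫ (e L).hom = (e K).hom ≫ HomologicalComplex.homologyMap f 0 :=
    ⟨fun K ↦ (homologyFunctorFactors (ModuleCat.{u} R) 0).app K,
      fun f ↦ homologyFunctorFactors_hom_naturality f 0⟩
  constructor
  · intro φ ψ h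
    have h : H.map φ = H.map ψ := by simpa [H] using h
    rw [← sub_eq_zero, ← cancel_epi p, comp_zero]
    obtain ⟨f, hf⟩ := (CochainComplex.IsKProjective.Qh_map_bijective P.cochainComplex
      ((HomotopyCategory.quotient _ _).obj W)).2 ((quotientCompQhIso _).hom.app _ ≫ p ≫ (φ - ψ) ≫
        (quotientCompQhIso _).inv.app _)
    obtain ⟨f, rfl⟩ := (HomotopyCategory.quotient _ _).map_surjective f
    have hf : Q.map f = p ≫ (φ - ψ) := by
      rw [← cancel_epi ((quotientCompQhIso _).hom.app P.cochainComplex),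
        ← quotientCompQhIso_hom_naturality, hf]
      simp
    have h₀ : HomologicalComplex.homologyMap f 0 = 0 := by
      rw [← cancel_epi (e P.cochainComplex).hom, ← he f, hf, H.map_comp, H.map_sub, h, sub_self,
        comp_zero, zero_comp, comp_zero]
    obtain ⟨h₁⟩ := CochainComplex.nonempty_homotopy_zero hZ hB f h₀
    rw [← hf, ← cancel_epi ((quotientCompQhIso _).hom.app P.cochainComplex),
      ← quotientCompQhIso_hom_naturality, HomotopyCategory.eq_of_homotopy _ _ h₁]
    simp
  · intro α
    obtain ⟨f, hf⟩ := CochainComplex.exists_homologyMap_eq hB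
      ((e _).inv ≫ H.map p ≫ (stalkHomologyIso M).hom ≫ α ≫ (e W).hom)
    refine ⟨inv p ≫ Q.map f, ?_⟩
    change _ ≫ H.map _ = _
    have h₁ : H.map (Q.map f) = H.map p ≫ (stalkHomologyIso M).hom ≫ α := by
      rw [← cancel_mono (e W).hom, he f, hf]
      simp
    rw [H.map_comp, h₁, ← H.map_comp_assoc, IsIso.inv_hom_id, H.map_id, Category.id_comp,
      Iso.inv_hom_id_assoc]

theorem stmt9 [HasExt.{w} (ModuleCat.{u} R)]
    (A B : Set (ModuleCat.{u} R))
    (hcp : IsCotorsionPair A B) (hhered : IsHereditaryCP A B)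
    (Y : CochainComplex (ModuleCat.{u} R) ℤ) (hY : IsCE B Y) :
    ∀ M ∈ A, ∀ s : ℤ,
      Function.Bijective (deltaMap M (DerivedCategory.Q.obj Y) s) := by
  intro M hM s
  let P := projectiveResolution M
  have h := bijective_stalk_of_extend P ((hY.cocyclesExtend hcp hhered hM P).shift s)
    ((hY.coboundariesExtend hcp hhered hM P).shift s)
  let c : Q.obj (Y⟦s⟧) ≅ (Q.obj Y)⟦s⟧ := (Q.commShiftIso s).app Y
  let t := (homologyFunctor (ModuleCat.{u} R) 0).mapIso c ≪≫
    shiftHomologyIso (Q.obj Y) s 0 s (add_zero s)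
  have ht : Function.Bijective fun f : M ⟶ _ ↦ f ≫ t.hom := (Iso.homToEquiv t).bijective
  have hc : Function.Bijective fun f : stalk M ⟶ _ ↦ f ≫ c.inv :=
    (Iso.homToEquiv c.symm).bijective
  convert! ht.comp (h.comp hc)
  ext1 f
  simp [deltaMap, t]
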